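/- Let H be a real Hilbert space, φ : H → ℝ a convex differentiable function whose gradient ∇φ is Lipschitz continuous on bounded subsets of H, and γ > 0. Suppose S := argmin_H φ is nonempty. Then for any initial data u₀, v₀ ∈ H, the unique solution u ∈ C²([0,∞); H) of ü(t) + γ u̇(t) + ∇φ(u(t)) = 0 with u(0) = u₀, u̇(0) = v₀ satisfies: (i) there exists u_∞ ∈ S such that u(t) converges weakly to u_∞ as t → +∞; (ii) ∫₀^∞ |u̇(s)|² ds < ∞ and |u̇(t)| → 0 as t → +∞. -/

import Mathlib

open Filter MeasureTheory Set Bornology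
open scoped RealInnerProductSpace NNReal Topology

section Auxiliary

variable {H : Type*} [NormedAddCommGroup H] [InnerProductSpace ℝ H]

/-- The gradient inequality for a differentiable convex function on a Hilbert space. -/
lemma ConvexOn.add_inner_gradient_le [CompleteSpace H] {φ : H → ℝ} {g x : H}
    (hφ : ConvexOn ℝ univ φ) (hg : HasGradientAt φ g x) (y : H) :
    φ x + ⟪g, y - x⟫ ≤ φ y := by
  have hconv : ConvexOn ℝ univ (φ ∘ AffineMap.lineMap (k := ℝ) x y) := by
    simpa using hφ.comp_affineMap (AffineMap.lineMap (k := ℝ) x y)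
  have hderiv : HasDerivAt (φ ∘ AffineMap.lineMap (k := ℝ) x y) ⟪g, y - x⟫ 0 := by
    have hx : HasFDerivAt φ (InnerProductSpace.toDual ℝ H g)
        (AffineMap.lineMap (k := ℝ) x y (0 : ℝ)) := by
      simpa using hg.hasFDerivAt
    simpa using hx.comp_hasDerivAt (0 : ℝ) AffineMap.hasDerivAt_lineMap
  have h := hconv.le_slope_of_hasDerivAt (mem_univ 0) (mem_univ 1) one_pos hderiv
  simp [slope_def_field] at h
  linarith

/-- A function that is antitone and bounded below on a half-line converges at infinity. -/
lemma AntitoneOn.exists_tendsto_atTop {f : ℝ → ℝ} {a c : ℝ} (hf : AntitoneOn f (Ici a))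
    (hc : ∀ t ∈ Ici a, c ≤ f t) : ∃ l, Tendsto f atTop (𝓝 l) := by
  have hanti : Antitone fun t => f (max t a) := fun s t hst =>
    hf (le_max_right s a) (le_max_right t a) (max_le_max_right a hst)
  have hbdd : BddBelow (range fun t => f (max t a)) :=
    ⟨c, by rintro _ ⟨t, rfl⟩; exact hc _ (le_max_right t a)⟩
  refine ⟨_, (tendsto_atTop_ciInf hanti hbdd).congr' ?_⟩
  filter_upwards [eventually_ge_atTop a] with t ht
  rw [max_eq_left ht]

lemma antitoneOn_Ici_of_hasDerivWithinAt_nonpos {f f' : ℝ → ℝ} {a : ℝ}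
    (hf : ∀ t ∈ Ici a, HasDerivWithinAt f (f' t) (Ici a) t) (hf' : ∀ t ∈ Ici a, f' t ≤ 0) :
    AntitoneOn f (Ici a) :=
  antitoneOn_of_hasDerivWithinAt_nonpos (convex_Ici a)
    (fun t ht => (hf t ht).continuousWithinAt)
    (fun t ht => (hf t (interior_subset ht)).mono interior_subset)
    (fun t ht => hf' t (interior_subset ht))

/-- A bounded family in a Hilbert space converges weakly along every ultrafilter. -/
lemma Ultrafilter.exists_tendsto_inner [CompleteSpace H] {α : Type*} (F : Ultrafilter α)
    {u : α → H} {R : ℝ} (hR : ∀ᶠ t in F, ‖u t‖ ≤ R) :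
    ∃ x, ∀ y, Tendsto (fun t => ⟪u t, y⟫) F (𝓝 ⟪x, y⟫) := by
  let w : α → WeakDual ℝ H := fun t =>
    StrongDual.toWeakDual (InnerProductSpace.toDual ℝ H (u t))
  have hmem : WeakDual.toStrongDual ⁻¹' Metric.closedBall (0 : StrongDual ℝ H) R ∈ F.map w := by
    refine Ultrafilter.mem_map.mpr (Filter.mem_of_superset hR fun t ht => ?_)
    simpa [w] using ht
  obtain ⟨ℓ, -, hℓ⟩ :=
    (WeakDual.isCompact_closedBall (𝕜 := ℝ) (0 : StrongDual ℝ H) R).ultrafilter_le_nhds' _ hmem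
  refine ⟨(InnerProductSpace.toDual ℝ H).symm (WeakDual.toStrongDual ℓ), fun y => ?_⟩
  have htendsto : Tendsto w F (𝓝 ℓ) := hℓ
  rw [InnerProductSpace.toDual_symm_apply]
  exact ((WeakDual.eval_continuous y).tendsto ℓ).comp htendsto

/-- **Opial's lemma** in a Hilbert space, with weak cluster points taken along ultrafilters. -/
lemma exists_weak_limit_of_tendsto_norm_sub [CompleteSpace H] {α : Type*} {l : Filter α} [l.NeBot]
    {u : α → H} {S : Set H} (hS : S.Nonempty)
    (hdist : ∀ z ∈ S, ∃ d, Tendsto (fun t => ‖u t - z‖ ^ 2) l (𝓝 d))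
    (hcluster : ∀ (F : Ultrafilter α) (x : H), ↑F ≤ l →
      (∀ y, Tendsto (fun t => ⟪u t, y⟫) F (𝓝 ⟪x, y⟫)) → x ∈ S) :
    ∃ x ∈ S, ∀ f : H →L[ℝ] ℝ, Tendsto (fun t => f (u t)) l (𝓝 (f x)) := by
  obtain ⟨R, hR⟩ : ∃ R, ∀ᶠ t in l, ‖u t‖ ≤ R := by
    obtain ⟨z, hz⟩ := hS
    obtain ⟨d, hd⟩ := hdist z hz
    refine ⟨‖z‖ + (d + 2), ?_⟩
    filter_upwards [hd.eventually (gt_mem_nhds (lt_add_one d))] with t ht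
    have := norm_le_norm_add_norm_sub' (u t) z
    nlinarith [sq_nonneg (‖u t - z‖ - 1 / 2)]
  have hlim (F : Ultrafilter α) (hF : ↑F ≤ l) :
      ∃ x ∈ S, ∀ y, Tendsto (fun t => ⟪u t, y⟫) F (𝓝 ⟪x, y⟫) := by
    obtain ⟨x, hx⟩ := F.exists_tendsto_inner (hR.filter_mono hF)
    exact ⟨x, hcluster F x hF hx, hx⟩
  obtain ⟨x, hxS, hx⟩ := hlim (Ultrafilter.of l) (Ultrafilter.of_le l)
  refine ⟨x, hxS, fun f => tendsto_iff_ultrafilter _ _ _ |>.mpr fun F hF => ?_⟩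
  obtain ⟨y, hyS, hy⟩ := hlim F hF
  obtain ⟨d, hd⟩ := hdist x hxS
  obtain ⟨e, he⟩ := hdist y hyS
  have hinner : Tendsto (fun t => ⟪u t, x - y⟫) l
      (𝓝 ((e - d + (‖x‖ ^ 2 - ‖y‖ ^ 2)) / 2)) := by
    refine (((he.sub hd).add_const _).div_const 2).congr fun t => ?_
    rw [norm_sub_sq_real, norm_sub_sq_real, inner_sub_right]
    ring
  have hxy : x = y := by
    have h₁ := tendsto_nhds_unique (hx (x - y)) (hinner.mono_left (Ultrafilter.of_le l))
    have h₂ := tendsto_nhds_unique (hy (x - y)) (hinner.mono_left hF)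
    rw [← sub_eq_zero, ← inner_self_eq_zero (𝕜 := ℝ), inner_sub_left, h₁, h₂, sub_self]
  subst hxy
  have := hy ((InnerProductSpace.toDual ℝ H).symm f)
  simpa only [real_inner_comm ((InnerProductSpace.toDual ℝ H).symm f),
    InnerProductSpace.toDual_symm_apply] using this

/-- Weak limits along an ultrafilter of a minimizing family are minimizers of a differentiable
convex function. -/
lemma ConvexOn.le_of_tendsto_inner [CompleteSpace H] {α : Type*} {F : Filter α} [F.NeBot]
    {φ : H → ℝ} {g x : H} {m : ℝ} {u : α → H} (hφ : ConvexOn ℝ univ φ) (hg : HasGradientAt φ g x)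
    (hu : Tendsto (fun t => φ (u t)) F (𝓝 m))
    (hx : ∀ y, Tendsto (fun t => ⟪u t, y⟫) F (𝓝 ⟪x, y⟫)) : φ x ≤ m := by
  have h : Tendsto (fun t => φ x + (⟪u t, g⟫ - ⟪x, g⟫)) F (𝓝 (φ x)) := by
    simpa using ((hx g).sub_const ⟪x, g⟫).const_add (φ x)
  refine le_of_tendsto_of_tendsto' h hu fun t => ?_
  have := hφ.add_inner_gradient_le hg (u t)
  rwa [real_inner_comm, inner_sub_left] at this

end Auxiliary

/-- (Heavy ball with friction, Alvarez' theorem.)  For a convex differentiable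
`φ` with gradient Lipschitz on bounded sets, `γ > 0`, and `argmin φ ≠ ∅`, every trajectory of
`ü + γu̇ + ∇φ(u) = 0` converges weakly to a minimizer of `φ`, the velocity is square integrable
and tends to `0` in norm. -/
theorem heavy_ball_with_friction_convergence
    {H : Type*} [NormedAddCommGroup H] [InnerProductSpace ℝ H] [CompleteSpace H]
    (φ : H → ℝ) (φ' : H → H) (γ : ℝ)
    (hφconv : ConvexOn ℝ univ φ)
    (hφgrad : ∀ x, HasGradientAt φ (φ' x) x)
    (hφlip : ∀ s : Set H, IsBounded s → ∃ K : ℝ≥0, LipschitzOnWith K φ' s)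
    (hγ : 0 < γ)
    (S : Set H) (hS : S = {x : H | ∀ y : H, φ x ≤ φ y}) (hSne : S.Nonempty)
    (u₀ v₀ : H) (u u' u'' : ℝ → H)
    (hu0 : u 0 = u₀) (hv0 : u' 0 = v₀)
    (hu : ∀ t ∈ Ici (0:ℝ), HasDerivWithinAt u (u' t) (Ici 0) t)
    (hu' : ∀ t ∈ Ici (0:ℝ), HasDerivWithinAt u' (u'' t) (Ici 0) t)
    (hu''cont : ContinuousOn u'' (Ici 0))
    (heq : ∀ t ∈ Ici (0:ℝ), u'' t + γ • u' t + φ' (u t) = 0) :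
    (∃ uinf ∈ S, ∀ f : H →L[ℝ] ℝ, Tendsto (fun t => f (u t)) atTop (𝓝 (f uinf))) ∧
    IntegrableOn (fun s => ‖u' s‖ ^ 2) (Ici 0) ∧
    Tendsto (fun t => ‖u' t‖) atTop (𝓝 0) := by
  obtain ⟨p, hp⟩ := hSne
  have hpmin : ∀ y, φ p ≤ φ y := by simpa [hS] using hp
  have hmin {z : H} (hz : z ∈ S) : φ z = φ p := by
    rw [hS] at hz
    exact le_antisymm (hz p) (hpmin z)
  have hacc (t : ℝ) (ht : t ∈ Ici (0 : ℝ)) : u'' t = -(γ • u' t) - φ' (u t) := by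
    rw [← sub_eq_zero, ← heq t ht]
    abel
  let E : ℝ → ℝ := fun t => ‖u' t‖ ^ 2 / 2 + (φ (u t) - φ p)
  have hEderiv (t : ℝ) (ht : t ∈ Ici (0 : ℝ)) :
      HasDerivWithinAt E (-γ * ‖u' t‖ ^ 2) (Ici 0) t := by
    have h₁ := ((hu' t ht).norm_sq).div_const 2
    have h₂ := ((hφgrad (u t)).hasFDerivAt.comp_hasDerivWithinAt t (hu t ht)).sub_const (φ p)
    refine (h₁.add h₂).congr_deriv ?_
    rw [InnerProductSpace.toDual_apply_apply, hacc t ht, inner_sub_right, inner_neg_right,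
      inner_smul_right, real_inner_self_eq_norm_sq, real_inner_comm (u' t)]
    ring
  have hEnonneg (t : ℝ) : 0 ≤ E t := by
    have := hpmin (u t)
    simp only [E]
    nlinarith [sq_nonneg ‖u' t‖]
  let G : H → ℝ → ℝ := fun z t =>
    ⟪u t - z, u' t⟫ + γ / 2 * ‖u t - z‖ ^ 2 + 3 / (2 * γ) * E t
  have hGderiv (z : H) (t : ℝ) (ht : t ∈ Ici (0 : ℝ)) :
      HasDerivWithinAt (G z) (-(‖u' t‖ ^ 2 / 2) - ⟪φ' (u t), u t - z⟫) (Ici 0) t := by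
    have h₁ := (hu t ht).sub_const z
    refine (((h₁.inner ℝ (hu' t ht)).add (h₁.norm_sq.const_mul (γ / 2))).add
      ((hEderiv t ht).const_mul (3 / (2 * γ)))).congr_deriv ?_
    rw [hacc t ht, inner_sub_right, inner_neg_right, inner_smul_right, real_inner_self_eq_norm_sq,
      real_inner_comm (φ' (u t))]
    field_simp
    ring
  have hGderiv_le {z : H} (hz : z ∈ S) (t : ℝ) :
      -(‖u' t‖ ^ 2 / 2) - ⟪φ' (u t), u t - z⟫ ≤ -E t := by
    have h := hφconv.add_inner_gradient_le (hφgrad (u t)) z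
    rw [← neg_sub (u t) z, inner_neg_right, hmin hz] at h
    simp only [E]
    linarith
  have hGlower (z : H) (t : ℝ) : γ / 6 * ‖u t - z‖ ^ 2 ≤ G z t := by
    have hE : ‖u' t‖ ^ 2 / 2 ≤ E t := by
      have := hpmin (u t)
      simp only [E]
      linarith
    have hE' := mul_le_mul_of_nonneg_left hE (by positivity : 0 ≤ 3 / (2 * γ))
    have hCS := neg_le_of_abs_le (abs_real_inner_le_norm (u t - z) (u' t))
    have hsq : 0 ≤ γ / 3 * ‖u t - z‖ ^ 2 - ‖u t - z‖ * ‖u' t‖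
        + 3 / (2 * γ) * (‖u' t‖ ^ 2 / 2) := by
      have : γ / 3 * ‖u t - z‖ ^ 2 - ‖u t - z‖ * ‖u' t‖ + 3 / (2 * γ) * (‖u' t‖ ^ 2 / 2)
          = (2 * γ * ‖u t - z‖ - 3 * ‖u' t‖) ^ 2 / (12 * γ) := by
        field_simp
        ring
      rw [this]
      positivity
    simp only [G]
    linarith
  have hGnonneg (z : H) (t : ℝ) : 0 ≤ G z t := le_trans (by positivity) (hGlower z t)
  have hGanti {z : H} (hz : z ∈ S) : AntitoneOn (G z) (Ici 0) :=
    antitoneOn_Ici_of_hasDerivWithinAt_nonpos (hGderiv z) fun t _ =>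
      (hGderiv_le hz t).trans (neg_nonpos.mpr (hEnonneg t))
  have hEdecay (t : ℝ) (ht : t ∈ Ici (0 : ℝ)) : t * E t ≤ G p 0 := by
    have hanti : AntitoneOn (fun t => G p t + t * E t) (Ici 0) := by
      refine antitoneOn_Ici_of_hasDerivWithinAt_nonpos (fun s hs =>
        (hGderiv p s hs).add ((hasDerivWithinAt_id s _).mul (hEderiv s hs))) fun s hs => ?_
      have hs' : 0 ≤ s * (γ * ‖u' s‖ ^ 2) := mul_nonneg hs (by positivity)
      have := hGderiv_le hp s
      simp only [id]
      linarith
    have h := hanti self_mem_Ici ht ht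
    simp only [zero_mul, add_zero] at h
    linarith [hGnonneg p t]
  have hElim : Tendsto E atTop (𝓝 0) := by
    refine squeeze_zero' (Eventually.of_forall hEnonneg) ?_
      (tendsto_const_nhds.div_atTop tendsto_id : Tendsto (fun t : ℝ => G p 0 / t) atTop (𝓝 0))
    filter_upwards [eventually_gt_atTop 0] with t ht
    rw [le_div_iff₀' ht]
    exact hEdecay t ht.le
  have hvel : Tendsto (fun t => ‖u' t‖) atTop (𝓝 0) := by
    have h : Tendsto (fun t => ‖u' t‖ ^ 2) atTop (𝓝 0) := by
      refine squeeze_zero (fun t => by positivity) (fun t => ?_)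
        (by simpa using hElim.const_mul 2 : Tendsto (fun t => 2 * E t) atTop (𝓝 0))
      have := hpmin (u t)
      simp only [E]
      linarith
    simpa using h.sqrt
  have hval : Tendsto (fun t => φ (u t)) atTop (𝓝 (φ p)) := by
    have h := (hElim.sub ((hvel.pow 2).div_const 2)).add_const (φ p)
    simpa [E] using h
  have hdist (z : H) (hz : z ∈ S) : ∃ d, Tendsto (fun t => ‖u t - z‖ ^ 2) atTop (𝓝 d) := by
    obtain ⟨l, hl⟩ := (hGanti hz).exists_tendsto_atTop fun t _ => hGnonneg z t
    have hbdd : IsBoundedUnder (· ≤ ·) atTop (norm ∘ fun t => ‖u t - z‖) := by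
      refine isBoundedUnder_of_eventually_le (a := 6 / γ * G z 0 + 1) ?_
      filter_upwards [eventually_ge_atTop 0] with t ht
      have h := (hGlower z t).trans (hGanti hz self_mem_Ici ht ht)
      have h' : ‖u t - z‖ ^ 2 ≤ 6 / γ * G z 0 := by
        calc ‖u t - z‖ ^ 2 = 6 / γ * (γ / 6 * ‖u t - z‖ ^ 2) := by field_simp
          _ ≤ _ := by gcongr
      simp only [Function.comp_apply, norm_norm]
      nlinarith [sq_nonneg (‖u t - z‖ - 1 / 2)]
    have hinner : Tendsto (fun t => ⟪u t - z, u' t⟫) atTop (𝓝 0) :=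
      squeeze_zero_norm (fun t => norm_inner_le_norm _ _)
        (isBoundedUnder_le_mul_tendsto_zero hbdd hvel)
    have h := ((hl.sub hinner).sub (hElim.const_mul (3 / (2 * γ)))).const_mul (2 / γ)
    refine ⟨_, h.congr fun t => ?_⟩
    simp only [G]
    field_simp
    ring
  refine ⟨exists_weak_limit_of_tendsto_norm_sub ⟨p, hp⟩ hdist fun F x hF hx => ?_, ?_, hvel⟩
  · rw [hS]
    exact fun y => (hφconv.le_of_tendsto_inner (hφgrad x) (hval.mono_left hF) hx).trans (hpmin y)
  · rw [integrableOn_Ici_iff_integrableOn_Ioi]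
    have h := integrableOn_Ioi_deriv_of_nonpos (hEderiv 0 self_mem_Ici).continuousWithinAt
      (fun t ht => (hEderiv t (Ioi_subset_Ici_self ht)).hasDerivAt (Ici_mem_nhds ht))
      (fun t _ => by nlinarith [sq_nonneg ‖u' t‖]) hElim
    refine (h.const_mul (-γ)⁻¹).congr (Eventually.of_forall fun t => ?_)
    simp only
    field_simp
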